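/- Under the assumptions of the TNNMG convergence theorem together with compatibility of the subspace decomposition ℝⁿ = Σ_{k=1}^m V_k with J, assume additionally that J has a unique global minimizer u*. Then the whole sequence (u^ν) generated by the TNNMG iteration converges to u*. -/

import Mathlib

open Filter Topology

/-- A coercive lower semicontinuous function has compact sublevel sets. -/
lemma isCompact_sublevel_of_coercive {E : Type*} [NormedAddCommGroup E] [ProperSpace E]
    {J : E → EReal} (hcoercive : ∀ c : ℝ, ∃ r : ℝ, ∀ x : E, r ≤ ‖x‖ → (c : EReal) ≤ J x)
    (hlsc : LowerSemicontinuous J) {c : EReal} (hc : c ≠ ⊤) : IsCompact {x | J x ≤ c} := by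
  obtain ⟨b, hcb, -⟩ := EReal.lt_iff_exists_real_btwn.1 (lt_top_iff_ne_top.2 hc)
  obtain ⟨r, hr⟩ := hcoercive b
  refine (isCompact_closedBall (0 : E) r).of_isClosed_subset (hlsc.isClosed_preimage c) ?_
  intro x hx
  rw [mem_closedBall_zero_iff]
  by_contra! h
  exact absurd ((hr x h.le).trans hx) (not_le.2 hcb)

section Descent

variable {E ι : Type*} {J : E → EReal} {Mop : ι → E → E}

/-- Successive non-increasing steps do not increase the functional. -/
lemma apply_foldl_le (hM : ∀ k v, J v ≠ ⊤ → J (Mop k v) ≤ J v) (l : List ι) {x : E}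
    (hx : J x ≠ ⊤) : J (l.foldl (fun w k => Mop k w) x) ≤ J x := by
  induction l generalizing x with
  | nil => exact le_rfl
  | cons k l ih =>
    have h := hM k x hx
    exact (ih (ne_top_of_le_ne_top hx h)).trans h

/-- If the functional values before and after a sweep of successive subspace corrections have the
same limit, then the limit of the starting points is minimal in each of the subspaces. -/
lemma minimal_of_tendsto_foldl [NormedAddCommGroup E] [NormedSpace ℝ E] [FiniteDimensional ℝ E]
    {α : Type*} {F : Ultrafilter α} {V : ι → Submodule ℝ E} {Mt : ι → E → E} {c d : EReal}
    (hc : c ≠ ⊤) (hK : IsCompact {x | J x ≤ c}) (hcont : ContinuousOn J {x | J x ≠ ⊤})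
    (huniq : ∀ w, J w ≠ ⊤ → ∀ k, ∃! z : E, z - w ∈ V k ∧ ∀ v ∈ V k, J z ≤ J (w + v))
    (hMsub : ∀ k v, J v ≠ ⊤ → Mop k v - v ∈ V k)
    (hmono : ∀ k v, J v ≠ ⊤ → J (Mop k v) ≤ J (Mt k v) ∧ J (Mt k v) ≤ J v)
    (hMtcont : ∀ k, ContinuousOn (fun v => J (Mt k v)) {x | J x ≠ ⊤})
    (hstable : ∀ k v, J v ≠ ⊤ → (∃ x ∈ V k, J (v + x) < J v) → J (Mt k v) < J v)
    (l : List ι) {a : α → E} {w : E} (ha : ∀ i, J (a i) ≤ c) (hw : J w ≤ c)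
    (haw : Tendsto a F (𝓝 w)) (had : Tendsto (fun i => J (a i)) F (𝓝 d))
    (hld : Tendsto (fun i => J (l.foldl (fun w k => Mop k w) (a i))) F (𝓝 d)) :
    ∀ k ∈ l, ∀ v ∈ V k, J w ≤ J (w + v) := by
  have hdom : ∀ {x}, J x ≤ c → J x ≠ ⊤ := fun h => ne_top_of_le_ne_top hc h
  have hlim : ∀ {g : E → EReal} {b : α → E} {z : E}, ContinuousOn g {x | J x ≠ ⊤} →
      (∀ i, J (b i) ≤ c) → J z ≤ c → Tendsto b F (𝓝 z) →
      Tendsto (fun i => g (b i)) F (𝓝 (g z)) := fun hg hb hz hbz =>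
    (hg _ (hdom hz)).tendsto.comp
      (tendsto_nhdsWithin_iff.2 ⟨hbz, Eventually.of_forall fun i => hdom (hb i)⟩)
  induction l generalizing a with
  | nil => simp
  | cons k l ih =>
    have hstep : ∀ i, J (Mop k (a i)) ≤ J (Mt k (a i)) ∧ J (Mt k (a i)) ≤ J (a i) :=
      fun i => hmono k _ (hdom (ha i))
    have hb : ∀ i, J (Mop k (a i)) ≤ c := fun i => ((hstep i).1.trans (hstep i).2).trans (ha i)
    have hfold : ∀ i, J (l.foldl (fun w k => Mop k w) (Mop k (a i))) ≤ J (Mop k (a i)) := fun i =>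
      apply_foldl_le (fun k v hv => (hmono k v hv).1.trans (hmono k v hv).2) l (hdom (hb i))
    have hbd : Tendsto (fun i => J (Mop k (a i))) F (𝓝 d) :=
      tendsto_of_tendsto_of_tendsto_of_le_of_le hld had hfold
        fun i => (hstep i).1.trans (hstep i).2
    have htd : Tendsto (fun i => J (Mt k (a i))) F (𝓝 d) :=
      tendsto_of_tendsto_of_tendsto_of_le_of_le hbd had (fun i => (hstep i).1)
        fun i => (hstep i).2
    have hJw : J w = d := tendsto_nhds_unique (hlim hcont ha hw haw) had
    have hJt : J (Mt k w) = d := tendsto_nhds_unique (hlim (g := fun v => J (Mt k v)) (hMtcont k) ha hw haw) htd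
    have hmin : ∀ v ∈ V k, J w ≤ J (w + v) := by
      intro v hv
      by_contra! h
      exact (hstable k w (hdom hw) ⟨v, hv, h⟩).ne (hJt.trans hJw.symm)
    obtain ⟨z, hz, hbz⟩ := hK.ultrafilter_le_nhds (F.map fun i => Mop k (a i))
      (le_principal_iff.2 (mem_map.2 (univ_mem' hb)))
    replace hbz : Tendsto (fun i => Mop k (a i)) F (𝓝 z) := hbz
    have hJz : J z = d := tendsto_nhds_unique (hlim hcont hb hz hbz) hbd
    have hzV : z - w ∈ V k := (V k).closed_of_finiteDimensional.mem_of_tendsto (hbz.sub haw)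
      (Eventually.of_forall fun i => hMsub k _ (hdom (ha i)))
    have hzw : z = w := (huniq w (hdom hw) k).unique
      ⟨hzV, fun v hv => (hJz.trans hJw.symm).trans_le (hmin v hv)⟩ ⟨by simp, hmin⟩
    subst hzw
    intro j hj
    rcases List.mem_cons.1 hj with rfl | hj
    · exact hmin
    · exact ih hb hbz hbd hld j hj

end Descent

/-- **Global convergence of TNNMG (Theorem `thm:gs_stationary`).**
Let `J : ℝⁿ → ℝ ∪ {∞}` be coercive, proper, lower semicontinuous, continuous on its domain,
and such that `J (w + ·)` has a unique global minimizer in every subspace `V k` for every `w`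
in the domain.  Given inexact local solvers `Mop k` (with corrections in `V k`), a correction
operator `C`, bounding operators `Mt k` satisfying monotonicity, continuity of `J ∘ Mt k`, and
stability, the TNNMG sequence `u (ν+1) = C ((Mop m ∘ ⋯ ∘ Mop 1) (u ν))` has only stationary
accumulation points; if moreover the subspace decomposition is compatible with `J` and `J`
has a unique global minimizer `ustar`, then the whole TNNMG sequence converges to `ustar`
(Corollary `cor:gs_convergence`). -/
theorem tnnmg_converges_to_unique_minimizer
    {n m : ℕ}
    (J : EuclideanSpace ℝ (Fin n) → EReal)
    (hproper : ∃ x, J x ≠ ⊤)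
    (hnobot : ∀ x, J x ≠ ⊥)
    (hcoercive : ∀ c : ℝ, ∃ r : ℝ, ∀ x : EuclideanSpace ℝ (Fin n), r ≤ ‖x‖ → (c : EReal) ≤ J x)
    (hlsc : LowerSemicontinuous J)
    (hcont : ContinuousOn J {x | J x ≠ ⊤})
    (V : Fin m → Submodule ℝ (EuclideanSpace ℝ (Fin n)))
    (huniq : ∀ w, J w ≠ ⊤ → ∀ k : Fin m,
      ∃! z : EuclideanSpace ℝ (Fin n), z - w ∈ V k ∧ ∀ v ∈ V k, J z ≤ J (w + v))
    (Mop Mt : Fin m → EuclideanSpace ℝ (Fin n) → EuclideanSpace ℝ (Fin n))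
    (C : EuclideanSpace ℝ (Fin n) → EuclideanSpace ℝ (Fin n))
    (hMsub : ∀ (k : Fin m) v, J v ≠ ⊤ → Mop k v - v ∈ V k)
    (hMtsub : ∀ (k : Fin m) v, J v ≠ ⊤ → Mt k v - v ∈ V k)
    (hmono : ∀ (k : Fin m) v, J v ≠ ⊤ → J (Mop k v) ≤ J (Mt k v) ∧ J (Mt k v) ≤ J v)
    (hCmono : ∀ v, J v ≠ ⊤ → J (C v) ≤ J v)
    (hMtcont : ∀ k : Fin m, ContinuousOn (fun v => J (Mt k v)) {x | J x ≠ ⊤})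
    (hstable : ∀ (k : Fin m) v, J v ≠ ⊤ → (∃ x ∈ V k, J (v + x) < J v) → J (Mt k v) < J v)
    (hcompat : ∀ w : EuclideanSpace ℝ (Fin n),
      (∀ k : Fin m, ∀ v ∈ V k, J w ≤ J (w + v)) →
      ∀ v : EuclideanSpace ℝ (Fin n), J w ≤ J (w + v))
    (u : ℕ → EuclideanSpace ℝ (Fin n))
    (hu0 : J (u 0) ≠ ⊤)
    (hiter : ∀ ν : ℕ,
      u (ν + 1) = C ((List.finRange m).foldl (fun w k => Mop k w) (u ν)))
    (ustar : EuclideanSpace ℝ (Fin n))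
    (hustar : ∀ v : EuclideanSpace ℝ (Fin n), J ustar ≤ J v)
    (hustar_uniq : ∀ w : EuclideanSpace ℝ (Fin n),
      (∀ v : EuclideanSpace ℝ (Fin n), J w ≤ J v) → w = ustar) :
    Filter.Tendsto u Filter.atTop (nhds ustar) := by
  let S : EuclideanSpace ℝ (Fin n) → EuclideanSpace ℝ (Fin n) :=
    fun x => (List.finRange m).foldl (fun w k => Mop k w) x
  have hSle : ∀ x, J x ≠ ⊤ → J (S x) ≤ J x := fun x hx =>
    apply_foldl_le (fun k v hv => (hmono k v hv).1.trans (hmono k v hv).2) _ hx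
  have hstep : ∀ x, J x ≠ ⊤ → J (C (S x)) ≤ J (S x) := fun x hx =>
    hCmono _ (ne_top_of_le_ne_top hx (hSle x hx))
  have hdom : ∀ ν, J (u ν) ≠ ⊤ := by
    intro ν
    induction ν with
    | zero => exact hu0
    | succ ν ih =>
      rw [hiter]
      exact ne_top_of_le_ne_top ih ((hstep _ ih).trans (hSle _ ih))
  have hnext : ∀ ν, J (u (ν + 1)) ≤ J (S (u ν)) := fun ν => by
    rw [hiter]
    exact hstep _ (hdom ν)
  have hanti : Antitone fun ν => J (u ν) :=
    antitone_nat_of_succ_le fun ν => (hnext ν).trans (hSle _ (hdom ν))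
  have hlim := tendsto_atTop_iInf hanti
  have hSlim := tendsto_of_tendsto_of_tendsto_of_le_of_le
    (hlim.comp (tendsto_add_atTop_nat 1)) hlim hnext fun ν => hSle _ (hdom ν)
  have hK := isCompact_sublevel_of_coercive hcoercive hlsc hu0
  have hu : ∀ ν, J (u ν) ≤ J (u 0) := fun ν => hanti (Nat.zero_le ν)
  rw [tendsto_iff_ultrafilter]
  intro F hF
  obtain ⟨w, hw, huw⟩ := hK.ultrafilter_le_nhds (F.map u)
    (le_principal_iff.2 (mem_map.2 (univ_mem' hu)))
  replace huw : Tendsto u F (𝓝 w) := huw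
  have hmin := minimal_of_tendsto_foldl hu0 hK hcont huniq hMsub hmono hMtcont hstable
    (List.finRange m) hu hw huw (hlim.mono_left hF) (hSlim.mono_left hF)
  have hglobal := hcompat w fun k => hmin k (List.mem_finRange k)
  rwa [hustar_uniq w fun v => by simpa using hglobal (v - w)] at huw
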